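/- arXiv:math/0603609 — 5 statements merged into one kernel-verified Lean document; each statement's English description precedes it below -/
import Mathlib

section
/- Every finite chordal simple graph with at least one vertex has a simplicial vertex, i.e., a vertex v such that the set of neighbors of v is a clique. -/
/-- A finite simple graph is chordal if every cycle of length at least 4 has a chord,
i.e., an edge of `G` joining two vertices of the cycle that are not consecutive on the
cycle (equivalently, the edge is not an edge of the cycle). -/
def IsChordal {V : Type*} (G : SimpleGraph V) : Prop :=
  ∀ ⦃v : V⦄ (c : G.Walk v v), c.IsCycle → 4 ≤ c.length →
    ∃ u w, u ∈ c.support ∧ w ∈ c.support ∧ G.Adj u w ∧ s(u, w) ∉ c.edges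

namespace SimpleGraph

variable {V : Type*} {G : SimpleGraph V}

/-- The support of a shortest walk induces no edges besides those of the walk. -/
lemma Walk.mem_edges_of_length_eq_dist {x y : V} (p : G.Walk x y) (hp : p.length = G.dist x y)
    {u w : V} (hu : u ∈ p.support) (hw : w ∈ p.support) (huw : G.Adj u w) :
    s(u, w) ∈ p.edges := by
  classical
  have key : ∀ {a b : V} (q₁ : G.Walk x a) (q : G.Walk a b) (q₂ : G.Walk b y),
      p = (q₁.append q).append q₂ → G.Adj a b → s(a, b) ∈ p.edges := by
    rintro a b q₁ q q₂ rfl hab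
    have h := G.dist_le ((q₁.append (Walk.cons hab Walk.nil)).append q₂)
    simp only [Walk.length_append, Walk.length_cons, Walk.length_nil] at h hp
    have hq : q.length ≤ 1 := by omega
    cases q with
    | nil => exact absurd hab (G.irrefl)
    | cons h₁ r =>
      cases r with
      | nil => simp
      | cons h₂ r => simp at hq
  have hsplit := p.take_spec hw
  have hu' := hu
  rw [← hsplit, Walk.mem_support_append_iff] at hu'
  rcases hu' with h | h
  · refine key ((p.takeUntil w hw).takeUntil u h) ((p.takeUntil w hw).dropUntil u h)
      (p.dropUntil w hw) ?_ huw
    rw [Walk.take_spec, hsplit]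
  · rw [Sym2.eq_swap]
    refine key (p.takeUntil w hw) ((p.dropUntil w hw).takeUntil u h)
      ((p.dropUntil w hw).dropUntil u h) ?_ huw.symm
    rw [← Walk.append_assoc, Walk.take_spec, hsplit]

/-- Any two vertices of a connected set are joined by an induced path within the set. -/
lemma exists_isPath_forall_adj_mem_edges {s : Set V} (hs : (G.induce s).Connected) {x y : V}
    (hx : x ∈ s) (hy : y ∈ s) :
    ∃ p : G.Walk x y, p.IsPath ∧ (∀ u ∈ p.support, u ∈ s) ∧
      ∀ u ∈ p.support, ∀ w ∈ p.support, G.Adj u w → s(u, w) ∈ p.edges := by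
  obtain ⟨p, hp, hlen⟩ := hs.exists_path_of_dist ⟨x, hx⟩ ⟨y, hy⟩
  let f : G.induce s →g G := (Embedding.induce s).toHom
  have hsupp : ∀ u ∈ (p.map f).support, ∃ h : u ∈ s, (⟨u, h⟩ : s) ∈ p.support := by
    intro u hu
    rw [Walk.support_map, List.mem_map] at hu
    obtain ⟨v, hv, rfl⟩ := hu
    exact ⟨v.2, hv⟩
  have hedges : ∀ u ∈ (p.map f).support, ∀ w ∈ (p.map f).support, G.Adj u w →
      s(u, w) ∈ (p.map f).edges := by
    intro u hu w hw huw
    obtain ⟨hus, hu⟩ := hsupp u hu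
    obtain ⟨hws, hw⟩ := hsupp w hw
    rw [Walk.edges_map]
    exact List.mem_map_of_mem (f := Sym2.map f) (p.mem_edges_of_length_eq_dist hlen hu hw huw)
  exact ⟨p.map f, hp.map Subtype.val_injective, fun u hu ↦ (hsupp u hu).1, hedges⟩

lemma Connected.induce_insert {s : Set V} (hs : (G.induce s).Connected) {a c : V} (ha : a ∈ s)
    (hac : G.Adj a c) : (G.induce (insert c s)).Connected := by
  have h := induce_union_connected (induce_pair_connected_of_adj hac).preconnected
    hs.preconnected ⟨a, by simp [ha]⟩
  have heq : ({a, c} ∪ s : Set V) = insert c s := by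
    ext z
    simp only [Set.mem_union, Set.mem_insert_iff, Set.mem_singleton_iff]
    grind
  rwa [heq] at h

end SimpleGraph

open SimpleGraph

namespace IsChordal

variable {V : Type*} {G : SimpleGraph V}

/-- In a chordal graph, two common neighbors of a vertex `b` that both have neighbors in a
connected set avoiding the closed neighborhood of `b` are adjacent. -/
lemma adj_of_connected (hG : IsChordal G) {s : Set V} (hs : (G.induce s).Connected)
    {b x y : V} (hb : b ∉ s) (hbs : ∀ a ∈ s, ¬ G.Adj a b) (hxy : x ≠ y)
    (hx : ∃ a ∈ s, G.Adj a x) (hy : ∃ a ∈ s, G.Adj a y) (hbx : G.Adj b x) (hby : G.Adj b y) :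
    G.Adj x y := by
  by_contra hnadj
  obtain ⟨a, ha, hax⟩ := hx
  obtain ⟨a', ha', hay⟩ := hy
  have hconn := (hs.induce_insert ha hax).induce_insert (Set.mem_insert_of_mem x ha') hay
  obtain ⟨p, hp, hps, hpe⟩ := exists_isPath_forall_adj_mem_edges hconn (x := x) (y := y)
    (by simp) (by simp)
  have hbp : b ∉ p.support := by
    intro h
    rcases hps b h with rfl | rfl | h
    exacts [G.irrefl hby, G.irrefl hbx, hb h]
  have hlen : 2 ≤ p.length := by
    by_contra! h
    have h0 : p.length ≠ 0 := fun h ↦ hxy (Walk.eq_of_length_eq_zero h)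
    exact hnadj (Walk.adj_of_length_eq_one (p := p) (by omega))
  have hc : (Walk.cons hbx (p.concat hby.symm)).IsCycle := by
    rw [Walk.cons_isCycle_iff]
    refine ⟨hp.concat hbp hby.symm, ?_⟩
    rw [Walk.edges_concat, List.concat_eq_append, List.mem_append, List.mem_singleton]
    rintro (h | h)
    · exact hbp (p.fst_mem_support_of_mem_edges h)
    · rw [Sym2.eq_swap, Sym2.congr_left] at h
      exact hxy h
  have hedge : ∀ w ∈ p.support, G.Adj b w → w = x ∨ w = y := by
    intro w hw hbw
    rcases hps w hw with rfl | rfl | h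
    exacts [.inr rfl, .inl rfl, absurd hbw.symm (hbs w h)]
  obtain ⟨u, w, hu, hw, huw, hn⟩ := hG _ hc (by simpa using hlen)
  simp only [Walk.support_cons, Walk.support_concat, Walk.edges_cons, Walk.edges_concat,
    List.concat_eq_append, List.mem_cons, List.mem_append, List.mem_nil_iff, or_false] at hu hw hn
  have := hpe u
  have := hedge u
  have := hedge w
  have := huw.symm
  have := huw.ne
  grind [Sym2.eq_swap]

/-- Every nonempty set of vertices of a finite chordal graph has a vertex that is simplicial in the
subgraph induced by the set. -/
lemma exists_isClique_neighborSet_inter [Finite V] (hG : IsChordal G) (S : Set V)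
    (hS : S.Nonempty) : ∃ v ∈ S, G.IsClique (G.neighborSet v ∩ S) := by
  induction S using WellFoundedLT.induction with
  | ind S ih =>
  by_cases hclique : G.IsClique S
  · obtain ⟨v, hv⟩ := hS
    exact ⟨v, hv, hclique.subset Set.inter_subset_right⟩
  obtain ⟨x, hx, y, hy, hxy, hnxy⟩ : ∃ x ∈ S, ∃ y ∈ S, x ≠ y ∧ ¬ G.Adj x y := by
    simpa [isClique_iff, Set.Pairwise] using hclique
  let far (A : Set V) : Set V := {z ∈ S | z ∉ A ∧ ∀ a ∈ A, ¬ G.Adj a z}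
  obtain ⟨A, hA⟩ := (Set.toFinite {A : Set V |
    A ⊆ S ∧ (G.induce A).Connected ∧ (far A).Nonempty}).exists_maximal
    ⟨{x}, by simpa using hx, by simp, y, hy, by simpa using hxy.symm, by simpa using hnxy⟩
  obtain ⟨hAS, hconn, hfar⟩ := hA.prop
  obtain ⟨a, ha⟩ := hconn.nonempty
  obtain ⟨v, hv, hvc⟩ := ih (far A)
    (Set.ssubset_iff_subset_ne.2 ⟨fun z hz ↦ hz.1, fun h ↦ (h.symm ▸ hAS ha : a ∈ far A).2.1 ha⟩)
    hfar
  have hmax : ∀ c ∈ S, c ∉ A → (∃ a ∈ A, G.Adj a c) → ∀ z ∈ far A, G.Adj z c := by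
    rintro c hc hcA ⟨a, ha, hac⟩ z ⟨hzS, hzA, hz⟩
    by_contra hzc
    refine hcA (hA.le_of_ge ⟨Set.insert_subset hc hAS, hconn.induce_insert ha hac, z, hzS, ?_, ?_⟩
      (Set.subset_insert c A) (Set.mem_insert c A))
    · rintro (rfl | h)
      exacts [hz a ha hac, hzA h]
    · rintro a' (rfl | h)
      exacts [fun h ↦ hzc h.symm, hz a' h]
  have hdich : ∀ c ∈ G.neighborSet v ∩ S,
      c ∈ far A ∨ c ∉ A ∧ ∃ a ∈ A, G.Adj a c := by
    rintro c ⟨hvc, hc⟩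
    have hcA : c ∉ A := fun h ↦ hv.2.2 c h hvc.symm
    by_cases h : ∃ a ∈ A, G.Adj a c
    · exact .inr ⟨hcA, h⟩
    · exact .inl ⟨hc, hcA, by simpa using h⟩
  refine ⟨v, hv.1, fun c hc d hd hcd ↦ ?_⟩
  rcases hdich c hc with hcf | ⟨hcA, hca⟩ <;> rcases hdich d hd with hdf | ⟨hdA, hda⟩
  · exact hvc ⟨hc.1, hcf⟩ ⟨hd.1, hdf⟩ hcd
  · exact hmax d hd.2 hdA hda c hcf
  · exact (hmax c hc.2 hcA hca d hdf).symm
  · exact hG.adj_of_connected hconn hv.2.1 hv.2.2 hcd hca hda hc.1 hd.1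

end IsChordal

/-- Every finite chordal simple graph with at least one vertex has a simplicial vertex,
i.e., a vertex whose neighborhood is a clique. -/
theorem stmt1 {V : Type*} [Fintype V] [Nonempty V] (G : SimpleGraph V)
    (hG : IsChordal G) :
    ∃ v : V, G.IsClique (G.neighborSet v) := by
  obtain ⟨v, -, hv⟩ := hG.exists_isClique_neighborSet_inter Set.univ Set.univ_nonempty
  exact ⟨v, by simpa using hv⟩
end

section
/- A finite simple graph G on n vertices is chordal if and only if it admits a perfect elimination ordering, i.e., an ordering v_1, …, v_n of all its vertices such that for each index i, the set of neighbors of v_i among {v_{i+1}, …, v_n} is a clique of G. -/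
namespace SimpleGraph

variable {V : Type*} {G : SimpleGraph V}

theorem Walk.mk_mem_edges_of_length_eq_dist {x y u w : V} {p : G.Walk x y}
    (hp : p.length = G.dist x y) (hu : u ∈ p.support) (hw : w ∈ p.support) (h : G.Adj u w) :
    s(u, w) ∈ p.edges := by
  have key : ∀ i j, i < j → j ≤ p.length → G.Adj (p.getVert i) (p.getVert j) →
      s(p.getVert i, p.getVert j) ∈ p.edges := by
    intro i j hij hj hadj
    have hle := dist_le ((p.take i).append (Walk.cons hadj (p.drop j)))
    simp only [Walk.length_append, Walk.length_cons, Walk.take_length, Walk.drop_length] at hle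
    obtain rfl : j = i + 1 := by omega
    exact (p.mk_mem_edges_iff_exists).2 ⟨i, by omega, rfl⟩
  obtain ⟨i, rfl, hi⟩ := Walk.mem_support_iff_exists_getVert.1 hu
  obtain ⟨j, rfl, hj⟩ := Walk.mem_support_iff_exists_getVert.1 hw
  rcases lt_trichotomy i j with hij | rfl | hij
  · exact key i j hij hj h
  · exact (G.loopless.irrefl _ h).elim
  · rw [Sym2.eq_swap]
    exact key j i hij hi h.symm

theorem Walk.IsCycle.mk_snd_penultimate_notMem_edges {v : V} {c : G.Walk v v} (hc : c.IsCycle)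
    (hlen : 4 ≤ c.length) : s(c.snd, c.penultimate) ∉ c.edges := by
  intro h
  obtain ⟨i, hi, he⟩ := (c.mk_mem_edges_iff_exists).1 h
  have inj : ∀ a b, 1 ≤ a → a ≤ c.length → 1 ≤ b → b ≤ c.length →
      c.getVert a = c.getVert b → a = b :=
    fun a b h1 h2 h3 h4 h5 => hc.getVert_injOn ⟨h1, h2⟩ ⟨h3, h4⟩ h5
  have h0 : c.getVert 0 = c.getVert c.length := by simp
  rcases Sym2.eq_iff.1 he with ⟨h1, h2⟩ | ⟨h1, h2⟩
  · have h2' := inj (i + 1) (c.length - 1) (by omega) (by omega) (by omega) (by omega) h2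
    have := inj i 1 (by omega) (by omega) (by omega) (by omega) h1
    omega
  · have h2' := inj (i + 1) 1 (by omega) (by omega) (by omega) (by omega) h2
    obtain rfl : i = 0 := by omega
    have := inj c.length (c.length - 1) (by omega) (by omega) (by omega) (by omega)
      (h0.symm.trans h1)
    omega

/-- The subgraph induced on `T`, as a graph on the original vertex type. -/
def restrictTo (G : SimpleGraph V) (T : Set V) : SimpleGraph V where
  Adj a b := a ∈ T ∧ b ∈ T ∧ G.Adj a b
  symm := ⟨fun _ _ h => ⟨h.2.1, h.1, h.2.2.symm⟩⟩
  loopless := ⟨fun _ h => G.loopless.irrefl _ h.2.2⟩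

theorem restrictTo_le (T : Set V) : G.restrictTo T ≤ G := fun _ _ h => h.2.2

theorem restrictTo_mono {T W : Set V} (h : T ⊆ W) : G.restrictTo T ≤ G.restrictTo W :=
  fun _ _ hab => ⟨h hab.1, h hab.2.1, hab.2.2⟩

theorem Walk.mem_of_mem_support_restrictTo {T : Set V} {a b : V} (p : (G.restrictTo T).Walk a b)
    (ha : a ∈ T) : ∀ u ∈ p.support, u ∈ T := by
  induction p with
  | nil => simpa using ha
  | cons h p ih =>
    intro u hu
    rw [Walk.support_cons, List.mem_cons] at hu
    rcases hu with rfl | hu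
    · exact ha
    · exact ih h.2.1 u hu

theorem adj_of_reachable_of_isChordal (hG : IsChordal G) {v x y a b : V} {T : Set V}
    (hT : ∀ t ∈ T, t ≠ v ∧ ¬ G.Adj v t) (hx : G.Adj v x) (hy : G.Adj v y) (hxy : x ≠ y)
    (ha : a ∈ T) (hb : b ∈ T) (hxa : G.Adj x a) (hyb : G.Adj y b)
    (hab : (G.restrictTo T).Reachable a b) : G.Adj x y := by
  by_contra hnadj
  let W : Set V := insert x (insert y T)
  have hxW : x ∈ W := Or.inl rfl
  have hyW : y ∈ W := Or.inr (Or.inl rfl)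
  have hTW : T ⊆ W := fun t ht => Or.inr (Or.inr ht)
  have hvW : v ∉ W := by
    rintro (rfl | rfl | h)
    · exact G.loopless.irrefl _ hx
    · exact G.loopless.irrefl _ hy
    · exact (hT v h).1 rfl
  have hreach : (G.restrictTo W).Reachable x y := by
    have h1 : (G.restrictTo W).Adj x a := ⟨hxW, hTW ha, hxa⟩
    have h2 : (G.restrictTo W).Adj b y := ⟨hTW hb, hyW, hyb.symm⟩
    exact (h1.reachable.trans (hab.mono (restrictTo_mono hTW))).trans h2.reachable
  obtain ⟨p, hp⟩ := hreach.exists_walk_length_eq_dist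
  have hpW := p.mem_of_mem_support_restrictTo hxW
  have hlen : 2 ≤ p.length := by
    have h0 : p.length ≠ 0 := fun h => hxy (Walk.eq_of_length_eq_zero h)
    have h1 : p.length ≠ 1 := fun h => hnadj (Walk.adj_of_length_eq_one h).2.2
    omega
  let q : G.Walk x y := p.mapLe (restrictTo_le W)
  have hqs : q.support = p.support := Walk.support_mapLe_eq_support ..
  have hqe : q.edges = p.edges := Walk.edges_mapLe_eq_edges ..
  have hql : q.length = p.length := Walk.length_mapLe ..
  have hq : q.IsPath := (p.isPath_of_length_eq_dist hp).mapLe _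
  have hvq : v ∉ q.support := fun h => hvW (hpW v (hqs ▸ h))
  let c : G.Walk v v := Walk.cons hx (q.concat hy.symm)
  have hc : c.IsCycle := by
    refine (Walk.cons_isCycle_iff _ _).2 ⟨(Walk.concat_isPath_iff _).2 ⟨hq, hvq⟩, fun h => ?_⟩
    rw [Walk.edges_concat, List.concat_eq_append, List.mem_append, List.mem_singleton] at h
    rcases h with h | h
    · exact hvq (Walk.fst_mem_support_of_mem_edges _ h)
    · rcases Sym2.eq_iff.1 h with ⟨h, -⟩ | ⟨-, h⟩
      · exact hy.ne h
      · exact hxy h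
  have hcs : ∀ u, u ∈ c.support → u = v ∨ u ∈ p.support := by
    intro u hu
    simp only [c, Walk.support_cons, Walk.support_concat, List.mem_cons, List.mem_append,
      hqs] at hu
    grind
  have hce : ∀ e, e = s(v, x) ∨ e = s(v, y) ∨ e ∈ p.edges → e ∈ c.edges := by
    intro e he
    simp only [c, Walk.edges_cons, Walk.edges_concat, List.concat_eq_append, List.mem_cons,
      List.mem_append, hqe]
    have : s(v, y) = s(y, v) := Sym2.eq_swap
    grind
  have hvadj : ∀ w ∈ p.support, G.Adj v w → s(v, w) ∈ c.edges := by
    intro w hw hvw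
    rcases hpW w hw with rfl | rfl | h
    · exact hce _ (Or.inl rfl)
    · exact hce _ (Or.inr (Or.inl rfl))
    · exact ((hT w h).2 hvw).elim
  obtain ⟨u, w, hu, hw, huw, hne⟩ := hG c hc (by
    simp only [c, Walk.length_cons, Walk.length_concat]; omega)
  apply hne
  rcases hcs u hu with rfl | hup
  · rcases hcs w hw with rfl | hwp
    · exact (G.loopless.irrefl _ huw).elim
    · exact hvadj w hwp huw
  · rcases hcs w hw with rfl | hwp
    · rw [Sym2.eq_swap]
      exact hvadj u hup huw.symm
    · exact hce _ (Or.inr (Or.inr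
        (Walk.mk_mem_edges_of_length_eq_dist hp hup hwp ⟨hpW u hup, hpW w hwp, huw⟩)))

theorem exists_simplicial_not_adj_of_isChordal [Finite V] (hG : IsChordal G) (S : Set V) :
    ∀ v ∈ S, (∃ w ∈ S, w ≠ v ∧ ¬ G.Adj v w) →
      ∃ w ∈ S, w ≠ v ∧ ¬ G.Adj v w ∧ G.IsClique {z ∈ S | G.Adj w z} := by
  induction S using WellFoundedLT.induction with
  | ind S ih =>
  rintro v hv ⟨w, hwS, hwv, hvw⟩
  let T : Set V := {t ∈ S | t ≠ v ∧ ¬ G.Adj v t}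
  let C : Set V := {u | (G.restrictTo T).Reachable w u}
  let N : Set V := {x ∈ S | G.Adj v x ∧ ∃ u ∈ C, G.Adj x u}
  have hwT : w ∈ T := ⟨hwS, hwv, hvw⟩
  have hCT : C ⊆ T := fun u ⟨p⟩ => p.mem_of_mem_support_restrictTo hwT u p.end_mem_support
  have hN : G.IsClique N := by
    rintro x ⟨-, hx, a, ha, hxa⟩ y ⟨-, hy, b, hb, hyb⟩ hxy
    exact adj_of_reachable_of_isChordal hG (T := T) (fun _ ht => ht.2) hx hy hxy (hCT ha) (hCT hb)
      hxa hyb (ha.symm.trans hb)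
  have hlt : C ∪ N < S := by
    refine (Set.ssubset_iff_of_subset ?_).2 ⟨v, hv, ?_⟩
    · rintro u (hu | hu)
      · exact (hCT hu).1
      · exact hu.1
    · rintro (hu | hu)
      · exact (hCT hu).2.1 rfl
      · exact G.loopless.irrefl _ hu.2.1
  have hnbr : ∀ u ∈ C, ∀ z ∈ S, G.Adj u z → z ∈ C ∪ N := by
    intro u hu z hz huz
    by_cases hvz : G.Adj v z
    · exact Or.inr ⟨hz, hvz, u, hu, huz.symm⟩
    · have hzT : z ∈ T := ⟨hz, fun h => (hCT hu).2.2 (h ▸ huz.symm), hvz⟩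
      have huz' : (G.restrictTo T).Adj u z := ⟨hCT hu, hzT, huz⟩
      exact Or.inl (Reachable.trans hu huz'.reachable)
  suffices h : ∃ u ∈ C, G.IsClique {z ∈ C ∪ N | G.Adj u z} by
    obtain ⟨u, hu, hcl⟩ := h
    refine ⟨u, (hCT hu).1, (hCT hu).2.1, (hCT hu).2.2, hcl.subset ?_⟩
    exact fun z hz => ⟨hnbr u hu z hz.1 hz.2, hz.2⟩
  by_cases hcl : G.IsClique (C ∪ N)
  · exact ⟨w, Reachable.refl w, hcl.subset fun z hz => hz.1⟩
  by_cases huniv : ∃ x ∈ N, ∃ z ∈ C ∪ N, z ≠ x ∧ ¬ G.Adj x z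
  · obtain ⟨x, hx, hz⟩ := huniv
    obtain ⟨u, hu, hux, hxu, hucl⟩ := ih _ hlt x (Or.inr hx) hz
    exact ⟨u, hu.resolve_right fun h => hxu (hN hx h hux.symm), hucl⟩
  · simp only [IsClique, Set.Pairwise, not_forall] at hcl
    obtain ⟨a, ha, b, hb, hab, hnab⟩ := hcl
    obtain ⟨u, hu, hua, hau, hucl⟩ := ih _ hlt a ha ⟨b, hb, hab.symm, hnab⟩
    exact ⟨u, hu.resolve_right fun h => huniv ⟨u, h, a, ha, hua.symm, fun h' => hau h'.symm⟩, hucl⟩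

theorem exists_simplicial_of_isChordal [Finite V] (hG : IsChordal G) {S : Set V}
    (hS : S.Nonempty) : ∃ v ∈ S, G.IsClique {z ∈ S | G.Adj v z} := by
  by_cases hcl : G.IsClique S
  · obtain ⟨v, hv⟩ := hS
    exact ⟨v, hv, hcl.subset fun z hz => hz.1⟩
  · simp only [IsClique, Set.Pairwise, not_forall] at hcl
    obtain ⟨a, ha, b, hb, hab, hnab⟩ := hcl
    obtain ⟨u, hu, -, -, hucl⟩ :=
      exists_simplicial_not_adj_of_isChordal hG S a ha ⟨b, hb, hab.symm, hnab⟩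
    exact ⟨u, hu, hucl⟩

theorem exists_perfectElimination_of_isChordal [Finite V] (hG : IsChordal G) (n : ℕ) :
    ∀ S : Set V, S.ncard = n → ∃ σ : Fin n → V, Function.Injective σ ∧ Set.range σ = S ∧
      ∀ i, G.IsClique {w | G.Adj (σ i) w ∧ ∃ j, i < j ∧ σ j = w} := by
  induction n with
  | zero =>
    intro S hS
    refine ⟨Fin.elim0, fun i => i.elim0, ?_, fun i => i.elim0⟩
    rw [(Set.ncard_eq_zero S.toFinite).1 hS]
    exact Set.range_eq_empty _
  | succ n ih =>
    intro S hS
    obtain ⟨v, hv, hcl⟩ := exists_simplicial_of_isChordal hG (S := S)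
      (Set.nonempty_of_ncard_ne_zero (by omega))
    obtain ⟨σ, hinj, hrange, hσ⟩ := ih (S \ {v}) (by
      rw [Set.ncard_sdiff_singleton_of_mem hv]; omega)
    refine ⟨Fin.cons v σ, ?_, ?_, ?_⟩
    · refine Fin.cons_injective_iff.2 ⟨?_, hinj⟩
      rw [hrange]
      exact fun h => h.2 rfl
    · rw [Fin.range_cons, hrange, Set.insert_sdiff_singleton, Set.insert_eq_of_mem hv]
    · intro i
      cases i using Fin.cases with
      | zero =>
        refine hcl.subset ?_
        rintro w ⟨hadj, j, hj, rfl⟩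
        cases j using Fin.cases with
        | zero => exact (lt_irrefl _ hj).elim
        | succ j =>
          have hj : σ j ∈ S \ {v} := hrange ▸ Set.mem_range_self j
          exact ⟨hj.1, hadj⟩
      | succ i =>
        refine (hσ i).subset ?_
        rintro w ⟨hadj, j, hj, rfl⟩
        cases j using Fin.cases with
        | zero => exact (Fin.not_lt_zero _ hj).elim
        | succ j => exact ⟨hadj, j, Fin.succ_lt_succ_iff.1 hj, rfl⟩

theorem isChordal_of_perfectElimination {ι : Type*} [LinearOrder ι] (σ : ι ≃ V)
    (hσ : ∀ i, G.IsClique {w | G.Adj (σ i) w ∧ ∃ j, i < j ∧ σ j = w}) : IsChordal G := by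
  classical
  intro v c hc hlen
  obtain ⟨m, hm, hmin⟩ := c.support.toFinset.exists_min_image σ.symm ⟨v, by simp⟩
  rw [List.mem_toFinset] at hm
  let d := c.rotate m hm
  have hd : d.IsCycle := hc.rotate hm
  have hmem : ∀ u, u ∈ d.support ↔ u ∈ c.support := fun u => Walk.mem_support_rotate_iff ..
  have hedges : ∀ e, e ∈ d.edges ↔ e ∈ c.edges := fun e => (c.rotate_edges m hm).mem_iff
  have hdlen : 4 ≤ d.length := by simpa [d] using hlen
  have hlater : ∀ u ∈ d.support, G.Adj m u →
      u ∈ {w | G.Adj (σ (σ.symm m)) w ∧ ∃ j, σ.symm m < j ∧ σ j = w} := by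
    intro u hu hmu
    refine ⟨by simpa using hmu, σ.symm u, ?_, by simp⟩
    refine lt_of_le_of_ne (hmin u (by simpa using (hmem u).1 hu)) fun h => ?_
    exact hmu.ne (σ.symm.injective h)
  have hsnd : d.snd ∈ d.support := d.getVert_mem_support _
  have hpen : d.penultimate ∈ d.support := d.getVert_mem_support _
  exact ⟨d.snd, d.penultimate, (hmem _).1 hsnd, (hmem _).1 hpen,
    hσ _ (hlater _ hsnd (d.adj_snd hd.not_nil)) (hlater _ hpen (d.adj_penultimate hd.not_nil).symm)
      hd.snd_ne_penultimate,
    fun h => hd.mk_snd_penultimate_notMem_edges hdlen ((hedges _).2 h)⟩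

end SimpleGraph

/-- A finite simple graph on `n` vertices is chordal iff it admits a perfect elimination
ordering: an ordering `σ` of all its vertices such that for each index `i`, the set of
neighbors of `σ i` among the later vertices `σ j`, `j > i`, is a clique of `G`. -/
theorem stmt3 {V : Type*} [Fintype V] (G : SimpleGraph V) :
    IsChordal G ↔ ∃ σ : Fin (Fintype.card V) ≃ V,
      ∀ i : Fin (Fintype.card V),
        G.IsClique {w : V | G.Adj (σ i) w ∧ ∃ j : Fin (Fintype.card V), i < j ∧ σ j = w} := by
  constructor
  · intro hG
    obtain ⟨σ, hinj, hrange, hσ⟩ := SimpleGraph.exists_perfectElimination_of_isChordal hG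
      (Fintype.card V) Set.univ (by rw [Set.ncard_univ, Nat.card_eq_fintype_card])
    exact ⟨Equiv.ofBijective σ ⟨hinj, Set.range_eq_univ.1 hrange⟩, hσ⟩
  · rintro ⟨σ, hσ⟩
    exact SimpleGraph.isChordal_of_perfectElimination σ hσ
end

section
/- A finite simple graph G is chordal if and only if its maximal cliques admit a perfect sequence, i.e., an ordering C_1, …, C_k of all the maximal cliques of G satisfying the running intersection property: for each 2 ≤ j ≤ k there exists 1 ≤ l ≤ j−1 such that S_j := C_j ∩ (C_1 ∪ … ∪ C_{j−1}) ⊆ C_l. -/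
/-- A maximal clique: a clique not properly contained in any other clique. -/
def IsMaxClique {V : Type*} (G : SimpleGraph V) (s : Set V) : Prop :=
  G.IsClique s ∧ ∀ t : Set V, G.IsClique t → s ⊆ t → s = t

namespace SimpleGraph

variable {V : Type*} {G : SimpleGraph V}

/-- A walk of minimal length inside a vertex set is an induced path. -/
theorem exists_induced_path {T : Set V} {u w : V} (p : G.Walk u w) (hp : ∀ z ∈ p.support, z ∈ T) :
    ∃ q : G.Walk u w, q.IsPath ∧ (∀ z ∈ q.support, z ∈ T) ∧
      ∀ a ∈ q.support, ∀ b ∈ q.support, G.Adj a b → s(a, b) ∈ q.edges := by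
  classical
  have hex : ∃ n, ∃ q : G.Walk u w, (∀ z ∈ q.support, z ∈ T) ∧ q.length = n := ⟨_, p, hp, rfl⟩
  obtain ⟨q₀, hq₀, hlen₀⟩ := Nat.find_spec hex
  have hmin : ∀ r : G.Walk u w, (∀ z ∈ r.support, z ∈ T) → Nat.find hex ≤ r.length :=
    fun r hr => Nat.find_min' hex ⟨r, hr, rfl⟩
  set q := q₀.bypass with hq
  have hqT : ∀ z ∈ q.support, z ∈ T := fun z hz => hq₀ z (q₀.support_bypass_subset_support hz)
  have hqmin : ∀ r : G.Walk u w, (∀ z ∈ r.support, z ∈ T) → q.length ≤ r.length := fun r hr =>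
    q₀.length_bypass_le_length.trans (hlen₀.trans_le (hmin r hr))
  refine ⟨q, q₀.bypass_isPath, hqT, ?_⟩
  have key : ∀ i j, i ≤ j → j ≤ q.length → G.Adj (q.getVert i) (q.getVert j) →
      s(q.getVert i, q.getVert j) ∈ q.edges := by
    intro i j hij hj hadj
    rcases Nat.lt_trichotomy j (i + 1) with h | rfl | h
    · obtain rfl : i = j := by lia
      exact absurd rfl hadj.ne
    · rw [← Walk.adj_toSubgraph_iff_mem_edges]
      exact q.toSubgraph_adj_getVert (by lia)
    · have := hqmin ((q.take i).append (Walk.cons hadj (q.drop j))) (by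
        intro z hz
        rw [Walk.mem_support_append_iff, Walk.support_cons, List.mem_cons] at hz
        rcases hz with hz | rfl | hz
        · exact hqT z ((q.isSubwalk_take i).support_subset hz)
        · exact hqT _ (q.getVert_mem_support i)
        · exact hqT z ((q.isSubwalk_drop j).support_subset hz))
      simp only [Walk.length_append, Walk.length_cons, Walk.take_length, Walk.drop_length] at this
      lia
  intro a ha b hb hab
  obtain ⟨i, rfl, hi⟩ := Walk.mem_support_iff_exists_getVert.1 ha
  obtain ⟨j, rfl, hj⟩ := Walk.mem_support_iff_exists_getVert.1 hb
  rcases le_total i j with h | h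
  · exact key i j h hj hab
  · rw [Sym2.eq_swap]
    exact key j i h hi hab.symm

/-- In a chordal graph, two neighbours of `x` that are connected by a walk whose other vertices
avoid `x` and its neighbours are adjacent. -/
theorem _root_.IsChordal.adj_of_walk (hG : IsChordal G) {T : Set V} {x u w : V} (hxu : G.Adj x u)
    (hxw : G.Adj x w) (huw : u ≠ w) (hT : ∀ z ∈ T, z ≠ x ∧ (G.Adj x z → z = u ∨ z = w))
    (p : G.Walk u w) (hp : ∀ z ∈ p.support, z ∈ T) : G.Adj u w := by
  by_contra hnadj
  obtain ⟨q, hq, hqT, hind⟩ := exists_induced_path p hp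
  have hxq : x ∉ q.support := fun h => (hT x (hqT x h)).1 rfl
  have hcyc : (Walk.cons hxu (q.concat hxw.symm)).IsCycle := by
    rw [Walk.cons_isCycle_iff]
    refine ⟨hq.concat hxq _, ?_⟩
    rw [Walk.edges_concat]
    simp only [List.concat_eq_append, List.mem_append, List.mem_singleton, not_or]
    refine ⟨fun h => hxq (q.fst_mem_support_of_mem_edges h), ?_⟩
    simp [hxw.ne, huw]
  have hlen : 4 ≤ (Walk.cons hxu (q.concat hxw.symm)).length := by
    rw [Walk.length_cons, Walk.length_concat]
    have h0 : q.length ≠ 0 := fun h => huw (Walk.eq_of_length_eq_zero h)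
    have h1 : q.length ≠ 1 := fun h => hnadj (Walk.adj_of_length_eq_one h)
    lia
  obtain ⟨a, b, ha, hb, hab, hnot⟩ := hG _ hcyc hlen
  have hsupp : ∀ z ∈ (Walk.cons hxu (q.concat hxw.symm)).support, z = x ∨ z ∈ q.support := by
    intro z hz
    simp only [Walk.support_cons, Walk.support_concat, List.mem_cons, List.mem_append,
      List.not_mem_nil, or_false] at hz
    tauto
  simp only [Walk.edges_cons, Walk.edges_concat, List.concat_eq_append, List.mem_cons,
    List.mem_append, List.not_mem_nil, or_false, not_or] at hnot
  have hxz : ∀ z ∈ q.support, G.Adj x z → s(x, z) = s(x, u) ∨ s(x, z) = s(w, x) := by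
    intro z hz hadj
    rcases (hT z (hqT z hz)).2 hadj with rfl | rfl
    · exact Or.inl rfl
    · exact Or.inr Sym2.eq_swap
  rcases hsupp a ha with rfl | haq <;> rcases hsupp b hb with rfl | hbq
  · exact hab.ne rfl
  · have := hxz b hbq hab
    tauto
  · have := hxz a haq hab.symm
    rw [Sym2.eq_swap] at hnot
    tauto
  · exact hnot.2.1 (hind a haq b hbq hab)

/-- In a chordal graph, every vertex `x` of `W` with a non-neighbour in `W` has a non-neighbour
which is simplicial in the subgraph induced by `W`. -/
theorem _root_.IsChordal.exists_simplicial_not_adj [Finite V] (hG : IsChordal G) (W : Set V) :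
    ∀ x ∈ W, (∃ a ∈ W, a ≠ x ∧ ¬ G.Adj x a) →
      ∃ y ∈ W, y ≠ x ∧ ¬ G.Adj x y ∧ G.IsClique (G.neighborSet y ∩ W) := by
  induction W using WellFoundedLT.induction with
  | ind W ih =>
  rintro x hx ⟨a, haW, hax, hnxa⟩
  set R : Set V := {z ∈ W | z ≠ x ∧ ¬ G.Adj x z} with hR
  set K : Set V := {z | ∃ p : G.Walk a z, ∀ t ∈ p.support, t ∈ R} with hK
  set S : Set V := {z ∈ W | G.Adj x z ∧ ∃ k ∈ K, G.Adj k z} with hS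
  have hKR : ∀ z ∈ K, z ∈ R := fun z ⟨p, hp⟩ => hp z p.end_mem_support
  have haK : a ∈ K := ⟨Walk.nil, by simp [hR, haW, hax, hnxa]⟩
  have hnbr : ∀ k ∈ K, ∀ z ∈ W, G.Adj k z → z ∈ K ∪ S := by
    intro k hk z hz hkz
    by_cases hxz : G.Adj x z
    · exact Or.inr ⟨hz, hxz, k, hk, hkz⟩
    · have hzx : z ≠ x := by
        rintro rfl
        exact (hKR k hk).2.2 hkz.symm
      obtain ⟨p, hp⟩ := hk
      refine Or.inl ⟨p.concat hkz, fun t ht => ?_⟩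
      simp only [Walk.support_concat, List.mem_append, List.mem_singleton] at ht
      rcases ht with ht | rfl
      · exact hp t ht
      · exact ⟨hz, hzx, hxz⟩
  have hSclique : G.IsClique S := by
    rintro u ⟨huW, hxu, k, ⟨p, hp⟩, hku⟩ w ⟨hwW, hxw, k', ⟨p', hp'⟩, hkw⟩ huw
    refine hG.adj_of_walk (T := insert u (insert w R)) hxu hxw huw ?_
      (Walk.cons hku.symm (p.reverse.append (p'.concat hkw))) ?_
    · rintro z (rfl | rfl | hz)
      · exact ⟨hxu.ne', fun _ => Or.inl rfl⟩
      · exact ⟨hxw.ne', fun _ => Or.inr rfl⟩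
      · exact ⟨hz.2.1, fun h => absurd h hz.2.2⟩
    · intro z hz
      simp only [Walk.support_cons, List.mem_cons, Walk.mem_support_append_iff,
        Walk.support_reverse, List.mem_reverse, Walk.support_concat, List.mem_append,
        List.not_mem_nil, or_false] at hz
      rcases hz with rfl | hz | hz | rfl
      · exact Or.inl rfl
      · exact Or.inr (Or.inr (hp z hz))
      · exact Or.inr (Or.inr (hp' z hz))
      · exact Or.inr (Or.inl rfl)
  have hHW : K ∪ S ⊆ W := by
    rintro z (hz | hz)
    · exact (hKR z hz).1
    · exact hz.1
  have hxH : x ∉ K ∪ S := by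
    rintro (h | h)
    · exact (hKR x h).2.1 rfl
    · exact G.irrefl h.2.1
  have hlt : K ∪ S < W := lt_of_le_of_ne hHW fun h => hxH (h ▸ hx)
  -- It suffices to find a vertex of `K` which is simplicial in `K ∪ S`.
  suffices h : ∃ y ∈ K, G.IsClique (G.neighborSet y ∩ (K ∪ S)) by
    obtain ⟨y, hy, hcl⟩ := h
    have hsub : G.neighborSet y ∩ W ⊆ G.neighborSet y ∩ (K ∪ S) :=
      fun z hz => ⟨hz.1, hnbr y hy z hz.2 hz.1⟩
    exact ⟨y, (hKR y hy).1, (hKR y hy).2.1, (hKR y hy).2.2, hcl.subset hsub⟩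
  by_cases hSu : ∃ s ∈ S, ∃ b ∈ K ∪ S, b ≠ s ∧ ¬ G.Adj s b
  · obtain ⟨s, hs, hb⟩ := hSu
    obtain ⟨y, hy, hys, hsy, hcl⟩ := ih _ hlt s (Or.inr hs) hb
    exact ⟨y, hy.resolve_right fun h => hsy (hSclique hs h hys.symm), hcl⟩
  push Not at hSu
  by_cases hKu : ∃ s ∈ K, ∃ b ∈ K ∪ S, b ≠ s ∧ ¬ G.Adj s b
  · obtain ⟨s, hs, hb⟩ := hKu
    obtain ⟨y, hy, hys, hsy, hcl⟩ := ih _ hlt s (Or.inl hs) hb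
    exact ⟨y, hy.resolve_right fun h => hsy (hSu y h s (Or.inl hs) hys.symm).symm, hcl⟩
  push Not at hKu
  refine ⟨a, haK, ?_⟩
  rintro b ⟨-, hb⟩ c ⟨-, hc⟩ hbc
  rcases hb with hb | hb
  · exact hKu b hb c hc hbc.symm
  · exact hSu b hb c hc hbc.symm

/-- Every nonempty induced subgraph of a chordal graph has a simplicial vertex. -/
theorem _root_.IsChordal.exists_simplicial [Finite V] (hG : IsChordal G) {W : Set V}
    (hW : W.Nonempty) : ∃ y ∈ W, G.IsClique (G.neighborSet y ∩ W) := by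
  obtain ⟨x, hx⟩ := hW
  by_cases h : G.IsClique W
  · exact ⟨x, hx, h.subset Set.inter_subset_right⟩
  · simp only [isClique_iff, Set.Pairwise] at h
    push Not at h
    obtain ⟨u, hu, w, hw, huw, hn⟩ := h
    obtain ⟨y, hy, -, -, hcl⟩ := hG.exists_simplicial_not_adj W u hu ⟨w, hw, huw.symm, hn⟩
    exact ⟨y, hy, hcl⟩

/-- `s` is a maximal clique of the subgraph of `G` induced by `W`. -/
def IsMaxCliqueIn (G : SimpleGraph V) (W s : Set V) : Prop :=
  Maximal (fun t => t ⊆ W ∧ G.IsClique t) s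

theorem isMaxCliqueIn_univ_iff {s : Set V} : IsMaxCliqueIn G Set.univ s ↔ IsMaxClique G s := by
  constructor
  · exact fun h => ⟨h.prop.2, fun t ht hst => h.eq_of_le ⟨Set.subset_univ t, ht⟩ hst⟩
  · exact fun h => ⟨⟨Set.subset_univ s, h.1⟩, fun t ht hst => (h.2 t ht.2 hst).ge⟩

/-- Adding a simplicial vertex `v` replaces the neighbourhood `N` of `v` by `insert v N` among the
maximal cliques. -/
theorem isMaxCliqueIn_iff_of_simplicial {W : Set V} {v : V} (hv : v ∈ W)
    (hcl : G.IsClique (G.neighborSet v ∩ W)) (s : Set V) :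
    IsMaxCliqueIn G W s ↔ s = insert v (G.neighborSet v ∩ W) ∨
      (IsMaxCliqueIn G (W \ {v}) s ∧ s ≠ G.neighborSet v ∩ W) := by
  set N := G.neighborSet v ∩ W with hN
  have hvN : v ∉ N := fun h => G.irrefl h.1
  have hQcl : G.IsClique (insert v N) := hcl.insert fun b hb _ => hb.1
  have hQW : insert v N ⊆ W := Set.insert_subset hv Set.inter_subset_right
  have hle : ∀ t ⊆ W, G.IsClique t → v ∈ t → t ⊆ insert v N := by
    intro t htW ht hvt z hz
    by_cases hzv : z = v
    · exact Or.inl hzv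
    · exact Or.inr ⟨ht hvt hz (Ne.symm hzv), htW hz⟩
  constructor
  · intro hs
    by_cases hvs : v ∈ s
    · exact Or.inl (hs.eq_of_le ⟨hQW, hQcl⟩ (hle s hs.prop.1 hs.prop.2 hvs))
    · refine Or.inr ⟨⟨⟨fun z hz => ⟨hs.prop.1 hz, ?_⟩, hs.prop.2⟩, fun t ht hst =>
        hs.2 ⟨ht.1.trans Set.sdiff_subset, ht.2⟩ hst⟩, ?_⟩
      · rintro rfl
        exact hvs hz
      · rintro rfl
        exact hvs (hs.2 ⟨hQW, hQcl⟩ (Set.subset_insert v N) (Set.mem_insert v N))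
  · rintro (rfl | ⟨hs, hsN⟩)
    · exact ⟨⟨hQW, hQcl⟩, fun t ht hst => hle t ht.1 ht.2 (hst (Set.mem_insert v N))⟩
    · refine ⟨⟨hs.prop.1.trans Set.sdiff_subset, hs.prop.2⟩, fun t ht hst => ?_⟩
      by_cases hvt : v ∈ t
      · refine absurd (hs.eq_of_le ⟨?_, hcl⟩ ?_) hsN
        · exact fun z hz => ⟨hz.2, fun h => hvN (h ▸ hz)⟩
        · exact fun z hz => (hle t ht.1 ht.2 hvt (hst hz)).resolve_left (hs.prop.1 hz).2
      · exact hs.2 ⟨fun z hz => ⟨ht.1 hz, fun h => hvt (h ▸ hz)⟩, ht.2⟩ hst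

/-- `C` enumerates the sets satisfying `P` with the running intersection property. -/
def IsPerfectSequence (P : Set V → Prop) {k : ℕ} (C : Fin k → Set V) : Prop :=
  Function.Injective C ∧ (∀ i, P (C i)) ∧ (∀ s, P s → ∃ i, C i = s) ∧
    ∀ j : Fin k, 0 < (j : ℕ) → ∃ l : Fin k, l < j ∧ (C j ∩ ⋃ (i : Fin k) (_ : i < j), C i) ⊆ C l

theorem IsPerfectSequence.exists_replace {P : Set V → Prop} {k : ℕ} {C : Fin k → Set V}
    (hC : IsPerfectSequence P C) {N : Set V} {v : V} (hv : ∀ s, P s → v ∉ s) (hN : P N) :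
    ∃ C' : Fin k → Set V,
      IsPerfectSequence (fun s => s = insert v N ∨ (P s ∧ s ≠ N)) C' := by
  obtain ⟨hinj, hP, hsurj, hrip⟩ := hC
  obtain ⟨i₀, rfl⟩ := hsurj N hN
  have hvC : ∀ i, v ∉ C i := fun i => hv _ (hP i)
  set C' : Fin k → Set V := Function.update C i₀ (insert v (C i₀)) with hC'
  have h₀ : C' i₀ = insert v (C i₀) := by simp [hC']
  have h₁ : ∀ i, i ≠ i₀ → C' i = C i := fun i hi => by simp [hC', hi]
  have hmem : ∀ i z, z ∈ C' i ↔ z ∈ C i ∨ (z = v ∧ i = i₀) := by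
    intro i z
    by_cases hi : i = i₀
    · subst hi
      simp [h₀, or_comm]
    · simp [h₁ i hi, hi]
  refine ⟨C', fun i j hij => hinj ?_, fun i => ?_, ?_, fun j hj => ?_⟩
  · ext z
    by_cases hz : z = v
    · subst hz
      simp [hvC]
    · simpa [hmem, hz] using Set.ext_iff.1 hij z
  · by_cases hi : i = i₀
    · exact Or.inl (hi ▸ h₀)
    · exact Or.inr ⟨h₁ i hi ▸ hP i, h₁ i hi ▸ fun h => hi (hinj h)⟩
  · rintro s (rfl | ⟨hs, hne⟩)
    · exact ⟨i₀, h₀⟩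
    · obtain ⟨i, rfl⟩ := hsurj s hs
      exact ⟨i, h₁ i fun h => hne (h ▸ rfl)⟩
  · obtain ⟨l, hl, hsub⟩ := hrip j hj
    refine ⟨l, hl, fun z ⟨hzj, hz⟩ => ?_⟩
    simp only [Set.mem_iUnion, exists_prop] at hz
    obtain ⟨i, hij, hzi⟩ := hz
    rw [hmem] at hzj hzi ⊢
    by_cases hzv : z = v
    · subst hzv
      simp only [hvC, true_and, false_or] at hzi hzj
      exact absurd (hzi.trans hzj.symm) hij.ne
    · simp only [hzv, false_and, or_false] at hzi hzj ⊢
      exact hsub ⟨hzj, Set.mem_biUnion hij hzi⟩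

theorem IsPerfectSequence.exists_append {P : Set V → Prop} {k : ℕ} {C : Fin k → Set V}
    (hC : IsPerfectSequence P C) {N : Set V} {v : V} (hv : ∀ s, P s → v ∉ s) (hN : ¬ P N)
    (hle : ∃ s, P s ∧ N ⊆ s) :
    ∃ C' : Fin (k + 1) → Set V,
      IsPerfectSequence (fun s => s = insert v N ∨ (P s ∧ s ≠ N)) C' := by
  obtain ⟨hinj, hP, hsurj, hrip⟩ := hC
  have hvC : ∀ i, v ∉ C i := fun i => hv _ (hP i)
  have hQ : ∀ i, C i ≠ insert v N := fun i h => hvC i (h ▸ Set.mem_insert v N)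
  refine ⟨Fin.snoc (α := fun _ => Set V) C (insert v N), ?_, ?_, ?_, ?_⟩
  · intro i j
    induction i using Fin.lastCases with
    | last =>
      induction j using Fin.lastCases with
      | last => simp
      | cast j => simpa using fun h => absurd h.symm (hQ j)
    | cast i =>
      induction j using Fin.lastCases with
      | last => simpa using hQ i
      | cast j => simpa using fun h => hinj h
  · intro i
    induction i using Fin.lastCases with
    | last => simp
    | cast i => simpa using Or.inr ⟨hP i, fun h => hN (h ▸ hP i)⟩
  · rintro s (rfl | ⟨hs, -⟩)
    · exact ⟨Fin.last k, by simp⟩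
    · obtain ⟨i, rfl⟩ := hsurj s hs
      exact ⟨i.castSucc, by simp⟩
  · intro j hj
    induction j using Fin.lastCases with
    | last =>
      obtain ⟨s, hs, hNs⟩ := hle
      obtain ⟨l, rfl⟩ := hsurj s hs
      refine ⟨l.castSucc, Fin.castSucc_lt_last l, fun z ⟨hzj, hz⟩ => ?_⟩
      simp only [Set.mem_iUnion, exists_prop] at hz
      obtain ⟨i, hij, hzi⟩ := hz
      induction i using Fin.lastCases with
      | last => exact absurd rfl hij.ne
      | cast i =>
        simp only [Fin.snoc_castSucc, Fin.snoc_last] at hzi hzj ⊢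
        rcases hzj with rfl | hzj
        · exact absurd hzi (hvC i)
        · exact hNs hzj
    | cast j =>
      obtain ⟨l, hl, hsub⟩ := hrip j (by simpa using hj)
      refine ⟨l.castSucc, by simpa using hl, fun z ⟨hzj, hz⟩ => ?_⟩
      simp only [Set.mem_iUnion, exists_prop] at hz
      obtain ⟨i, hij, hzi⟩ := hz
      induction i using Fin.lastCases with
      | last => exact absurd hij (Fin.castSucc_lt_last j).not_gt
      | cast i =>
        simp only [Fin.snoc_castSucc] at hzi hzj ⊢
        exact hsub ⟨hzj, Set.mem_biUnion (show i < j by simpa using hij) hzi⟩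

theorem _root_.IsChordal.exists_isPerfectSequence [Finite V] (hG : IsChordal G) (W : Set V) :
    ∃ (k : ℕ) (C : Fin k → Set V), IsPerfectSequence (IsMaxCliqueIn G W) C := by
  induction W using WellFoundedLT.induction with
  | ind W ih =>
  rcases W.eq_empty_or_nonempty with rfl | hW
  · refine ⟨1, fun _ => ∅, Function.injective_of_subsingleton _, fun _ => ?_, fun s hs => ?_, ?_⟩
    · exact ⟨⟨subset_rfl, by simp⟩, fun t ht _ => ht.1⟩
    · exact ⟨0, (Set.subset_empty_iff.1 hs.prop.1).symm⟩
    · intro j hj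
      lia
  obtain ⟨v, hv, hcl⟩ := hG.exists_simplicial hW
  obtain ⟨k, C, hC⟩ := ih (W \ {v}) (Set.sdiff_singleton_ssubset.2 hv)
  have hvs : ∀ s, IsMaxCliqueIn G (W \ {v}) s → v ∉ s := fun s hs h => (hs.prop.1 h).2 rfl
  rw [show IsMaxCliqueIn G W = _ from
    funext fun s => propext (isMaxCliqueIn_iff_of_simplicial hv hcl s)]
  by_cases hN : IsMaxCliqueIn G (W \ {v}) (G.neighborSet v ∩ W)
  · exact ⟨k, hC.exists_replace hvs hN⟩
  · refine ⟨k + 1, hC.exists_append hvs hN ?_⟩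
    obtain ⟨s, hNs, hs⟩ := Set.Finite.exists_le_maximal
      (s := {t : Set V | t ⊆ W \ {v} ∧ G.IsClique t}) (Set.toFinite _)
      (a := G.neighborSet v ∩ W) ⟨fun z hz => ⟨hz.2, fun h => G.irrefl (h ▸ hz.1 :)⟩, hcl⟩
    exact ⟨s, hs, hNs⟩

/-- A graph is chordal as soon as its vertices can be ranked so that the neighbours of each vertex
of at most the same rank are pairwise adjacent. -/
theorem isChordal_of_rank (f : V → ℕ)
    (hf : ∀ v u w, G.Adj v u → G.Adj v w → u ≠ w → f u ≤ f v → f w ≤ f v → G.Adj u w) :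
    IsChordal G := by
  classical
  intro x c₀ hc₀ hlen
  obtain ⟨v, hv, hmax⟩ := c₀.support.toFinset.exists_max_image f ⟨x, by simp⟩
  simp only [List.mem_toFinset] at hv hmax
  suffices h : ∀ c : G.Walk v v, c.IsCycle → 4 ≤ c.length → (∀ z ∈ c.support, f z ≤ f v) →
      ∃ u w, u ∈ c.support ∧ w ∈ c.support ∧ G.Adj u w ∧ s(u, w) ∉ c.edges by
    obtain ⟨u, w, hu, hw, huw, hne⟩ := h (c₀.rotate v hv) (hc₀.rotate hv) (by simpa using hlen)
      fun z hz => hmax z ((c₀.mem_support_rotate_iff v hv).1 hz)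
    exact ⟨u, w, (c₀.mem_support_rotate_iff v hv).1 hu, (c₀.mem_support_rotate_iff v hv).1 hw,
      huw, fun h => hne ((c₀.rotate_edges v hv).mem_iff.2 h)⟩
  intro c hc hlen hmax
  cases c with
  | nil => simp at hlen
  | cons hvu p =>
    rename_i u
    rw [Walk.cons_isCycle_iff] at hc
    rw [Walk.length_cons] at hlen
    have hnil : ¬ p.Nil := by
      rw [← Walk.length_eq_zero_iff]
      lia
    have hwv : G.Adj p.penultimate v := p.adj_penultimate hnil
    have hinj : ∀ i ≤ p.length, ∀ j ≤ p.length, p.getVert i = p.getVert j → i = j :=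
      fun i hi j hj h => hc.1.getVert_injOn hi hj h
    have huw : u ≠ p.penultimate := fun h => by
      have := hinj 0 (by lia) (p.length - 1) (by lia) (by simpa using h)
      lia
    have hus : u ∈ (Walk.cons hvu p).support := by simp
    have hws : p.penultimate ∈ (Walk.cons hvu p).support := by simp
    refine ⟨u, p.penultimate, hus, hws,
      hf v _ _ hvu hwv.symm huw (hmax _ hus) (hmax _ hws), fun h => ?_⟩
    rw [Walk.edges_cons, List.mem_cons] at h
    rcases h with h | h
    · rcases Sym2.eq_iff.1 h with ⟨h, -⟩ | ⟨-, h⟩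
      · exact hvu.ne' h
      · exact hwv.ne h
    · have := hinj _ (by lia) 1 (by lia) (hc.1.eq_snd_of_mem_edges h)
      lia

theorem exists_isMaxClique_of_isClique [Finite V] {t : Set V} (ht : G.IsClique t) :
    ∃ s, t ⊆ s ∧ IsMaxClique G s := by
  obtain ⟨s, hts, hs⟩ := Set.Finite.exists_le_maximal
    (s := {t : Set V | G.IsClique t}) (Set.toFinite _) ht
  exact ⟨s, hts, hs.prop, fun t ht hst => hs.eq_of_le ht hst⟩

theorem IsPerfectSequence.isChordal [Finite V] {k : ℕ} {C : Fin k → Set V}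
    (hC : IsPerfectSequence (IsMaxClique G) C) : IsChordal G := by
  classical
  obtain ⟨-, hmax, hsurj, hrip⟩ := hC
  have hcov : ∀ t, G.IsClique t → ∃ i, t ⊆ C i := by
    intro t ht
    obtain ⟨s, hts, hs⟩ := exists_isMaxClique_of_isClique ht
    obtain ⟨i, rfl⟩ := hsurj s hs
    exact ⟨i, hts⟩
  have hfirst : ∀ v, ∃ i, v ∈ C i ∧ ∀ j, v ∈ C j → i ≤ j := by
    intro v
    obtain ⟨i, hi⟩ := hcov {v} (by simp)
    obtain ⟨m, hm⟩ := WellFounded.has_min (wellFounded_lt (α := Fin k)) {i | v ∈ C i}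
      ⟨i, hi rfl⟩
    exact ⟨m, hm.1, fun j hj => not_lt.1 (hm.2 j hj)⟩
  choose f hfmem hfle using hfirst
  have key : ∀ v u, G.Adj v u → f u ≤ f v → u ∈ C (f v) := by
    intro v u hvu hle
    obtain ⟨i, hi⟩ := hcov {v, u} (by simp [hvu])
    obtain ⟨m, hm, hmmin⟩ := WellFounded.has_min (wellFounded_lt (α := Fin k))
      {i | ({v, u} : Set V) ⊆ C i} ⟨i, hi⟩
    have hvm : v ∈ C m := hm (by simp)
    have hum : u ∈ C m := hm (by simp)
    rcases (hfle v m hvm).eq_or_lt with h | h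
    · exact h ▸ hum
    · obtain ⟨l, hl, hsub⟩ := hrip m ((Nat.zero_le _).trans_lt h)
      refine absurd hl (hmmin l ?_)
      rintro z (rfl | rfl)
      · exact hsub ⟨hvm, Set.mem_biUnion h (hfmem _)⟩
      · exact hsub ⟨hum, Set.mem_biUnion (hle.trans_lt h) (hfmem _)⟩
  exact isChordal_of_rank (fun v => (f v : ℕ)) fun v u w hvu hvw huw hu hw =>
    (hmax (f v)).1 (key v u hvu hu) (key v w hvw hw) huw

end SimpleGraph

/-- A finite simple graph is chordal iff its maximal cliques admit a perfect sequence,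
i.e., an enumeration `C 0, …, C (k-1)` of all the maximal cliques satisfying the running
intersection property: for each `j` with `0 < j` there is `l < j` with
`C j ∩ (C 0 ∪ … ∪ C (j-1)) ⊆ C l`. -/
theorem stmt4 {V : Type*} [Fintype V] (G : SimpleGraph V) :
    IsChordal G ↔ ∃ (k : ℕ) (C : Fin k → Set V),
      Function.Injective C ∧
      (∀ i : Fin k, IsMaxClique G (C i)) ∧
      (∀ s : Set V, IsMaxClique G s → ∃ i : Fin k, C i = s) ∧
      (∀ j : Fin k, 0 < (j : ℕ) → ∃ l : Fin k, l < j ∧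
        (C j ∩ ⋃ (i : Fin k) (_ : i < j), C i) ⊆ C l) := by
  constructor
  · intro hG
    obtain ⟨k, C, hC⟩ := hG.exists_isPerfectSequence Set.univ
    rw [show G.IsMaxCliqueIn Set.univ = IsMaxClique G from
      funext fun s => propext SimpleGraph.isMaxCliqueIn_univ_iff] at hC
    exact ⟨k, C, hC⟩
  · rintro ⟨k, C, hC⟩
    exact SimpleGraph.IsPerfectSequence.isChordal hC
end

section
/- Let G be a connected finite chordal simple graph with at least two maximal cliques, and let (C_1, …, C_k) be a perfect sequence of G with S_j := C_j ∩ (C_1 ∪ … ∪ C_{j−1}) for 2 ≤ j ≤ k. Then each S_j is a minimal vertex separator of G, and conversely every minimal vertex separator of G equals S_j for some 2 ≤ j ≤ k. -/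
/-- The `j`-th separator of a sequence of cliques:
`S j = C j ∩ (C 0 ∪ … ∪ C (j-1))`. -/
def sep {V : Type*} {k : ℕ} (C : Fin k → Set V) (j : Fin k) : Set V :=
  C j ∩ ⋃ (i : Fin k) (_ : i < j), C i

/-- A perfect sequence of `G`: an enumeration of all maximal cliques of `G` satisfying
the running intersection property. -/
def IsPerfectSeq {V : Type*} (G : SimpleGraph V) {k : ℕ} (C : Fin k → Set V) : Prop :=
  Function.Injective C ∧
  (∀ i : Fin k, IsMaxClique G (C i)) ∧
  (∀ s : Set V, IsMaxClique G s → ∃ i : Fin k, C i = s) ∧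
  (∀ j : Fin k, 0 < (j : ℕ) → ∃ l : Fin k, l < j ∧ sep C j ⊆ C l)

/-- For distinct nonadjacent `a, b`, a set `S` with `a, b ∉ S` is an `(a,b)`-separator
if `a` and `b` lie in different connected components of the subgraph induced on `Sᶜ`. -/
def IsSeparator {V : Type*} (G : SimpleGraph V) (a b : V) (S : Set V) : Prop :=
  ∃ (ha : a ∈ Sᶜ) (hb : b ∈ Sᶜ), ¬ (G.induce Sᶜ).Reachable ⟨a, ha⟩ ⟨b, hb⟩

/-- `S` is a minimal vertex separator of `G` if it is an `(a,b)`-separator for some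
distinct nonadjacent pair `a, b` and no proper subset of `S` is an `(a,b)`-separator
for that pair. -/
def IsMinimalSeparator {V : Type*} (G : SimpleGraph V) (S : Set V) : Prop :=
  ∃ a b : V, a ≠ b ∧ ¬ G.Adj a b ∧ IsSeparator G a b S ∧ ∀ T ⊂ S, ¬ IsSeparator G a b T

theorem SimpleGraph.IsClique.exists_isMaxClique {V : Type*} [Finite V] {G : SimpleGraph V}
    {s : Set V} (hs : G.IsClique s) : ∃ t, s ⊆ t ∧ IsMaxClique G t := by
  obtain ⟨t, hst, ht⟩ := (Set.toFinite {t : Set V | G.IsClique t}).exists_le_maximal hs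
  exact ⟨t, hst, ht.prop, fun u hu htu => htu.antisymm (ht.le_of_ge hu htu)⟩

theorem IsMaxClique.exists_mem_notMem {V : Type*} {G : SimpleGraph V} {s t : Set V}
    (hs : IsMaxClique G s) (ht : IsMaxClique G t) (hne : s ≠ t) : ∃ a ∈ s, a ∉ t := by
  by_contra! h
  exact hne (hs.2 t ht.1 h)

theorem IsSeparator.symm {V : Type*} {G : SimpleGraph V} {a b : V} {S : Set V}
    (h : IsSeparator G a b S) : IsSeparator G b a S := by
  obtain ⟨ha, hb, h⟩ := h
  exact ⟨hb, ha, fun h' => h h'.symm⟩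

theorem IsSeparator.ne {V : Type*} {G : SimpleGraph V} {a b : V} {S : Set V}
    (h : IsSeparator G a b S) : a ≠ b := by
  obtain ⟨ha, hb, h⟩ := h
  rintro rfl
  exact h .rfl

theorem IsSeparator.not_adj {V : Type*} {G : SimpleGraph V} {a b : V} {S : Set V}
    (h : IsSeparator G a b S) : ¬ G.Adj a b := by
  obtain ⟨ha, hb, h⟩ := h
  intro hab
  exact h (SimpleGraph.Adj.reachable (G := G.induce Sᶜ) (u := ⟨a, ha⟩) (v := ⟨b, hb⟩) hab)

/-- Two vertices of a common clique outside `S` are separated by `S` from the same vertices. -/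
theorem IsSeparator.of_isClique {V : Type*} {G : SimpleGraph V} {a b s : V} {S D : Set V}
    (h : IsSeparator G a b S) (hD : G.IsClique D) (ha : a ∈ D) (hs : s ∈ D) (hsS : s ∉ S) :
    IsSeparator G s b S := by
  obtain rfl | hne := eq_or_ne a s
  · exact h
  obtain ⟨haS, hb, h⟩ := h
  have hr : (G.induce Sᶜ).Reachable ⟨a, haS⟩ ⟨s, hsS⟩ :=
    SimpleGraph.Adj.reachable (G := G.induce Sᶜ) (u := ⟨a, haS⟩) (v := ⟨s, hsS⟩) (hD ha hs hne)
  exact ⟨hsS, hb, fun h' => h (hr.trans h')⟩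

theorem isSeparator_of_closed {V : Type*} {G : SimpleGraph V} {a b : V} {S A : Set V}
    (ha : a ∉ S) (hb : b ∉ S) (haA : a ∈ A) (hbA : b ∉ A)
    (hA : ∀ u v, G.Adj u v → u ∉ S → v ∉ S → u ∈ A → v ∈ A) : IsSeparator G a b S := by
  refine ⟨ha, hb, fun ⟨p⟩ => ?_⟩
  have key : ∀ u v : (Sᶜ : Set V), (G.induce Sᶜ).Walk u v → (u : V) ∈ A → (v : V) ∈ A := by
    intro u v p
    induction p with
    | nil => exact id
    | @cons u v _ h _ ih => exact fun hu => ih (hA u v h u.2 v.2 hu)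
  exact hbA (key _ _ p haA)

theorem mem_sep {V : Type*} {k : ℕ} {C : Fin k → Set V} {j : Fin k} {x : V} :
    x ∈ sep C j ↔ x ∈ C j ∧ ∃ i, i < j ∧ x ∈ C i := by
  simp [sep]

/-- The vertices of the first `m` cliques outside `sep C j` split into two sides, each clique
lying on one side, with `C j` and the earlier cliques on opposite sides. -/
theorem IsPerfectSeq.exists_side {V : Type*} {G : SimpleGraph V} {k : ℕ} {C : Fin k → Set V}
    (hC : IsPerfectSeq G C) (j : Fin k) (m : ℕ) (hm : (j : ℕ) < m) :
    ∃ A : Set V, (∀ i < j, C i \ sep C j ⊆ A) ∧ C j ∩ A ⊆ sep C j ∧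
      (∀ x ∈ A, ∃ i : Fin k, (i : ℕ) < m ∧ x ∈ C i) ∧
      ∀ i : Fin k, (i : ℕ) < m → C i \ sep C j ⊆ A ∨ C i ∩ A ⊆ sep C j := by
  induction m, hm using Nat.le_induction with
  | base =>
    have hj : C j ∩ (⋃ (i : Fin k) (_ : i < j), C i) ⊆ sep C j := subset_rfl
    have hlt : ∀ i < j, C i \ sep C j ⊆ ⋃ (i : Fin k) (_ : i < j), C i :=
      fun i hi => Set.sdiff_subset.trans (Set.subset_biUnion_of_mem (u := C) hi)
    refine ⟨⋃ (i : Fin k) (_ : i < j), C i, hlt, hj, fun x hx => ?_, fun i hi => ?_⟩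
    · simp only [Set.mem_iUnion] at hx
      obtain ⟨i, hi, hx⟩ := hx
      exact ⟨i, Nat.lt_succ_of_lt hi, hx⟩
    · obtain h | h := (Nat.lt_succ_iff_lt_or_eq.mp hi)
      · exact .inl (hlt i h)
      · exact .inr (Fin.ext h ▸ hj)
  | succ m hm ih =>
    obtain ⟨A, hlt, hj, hsub, hA⟩ := ih
    by_cases hmk : m < k
    swap
    · exact ⟨A, hlt, hj, fun x hx => (hsub x hx).imp fun i h => ⟨h.1.trans m.lt_succ_self, h.2⟩,
        fun i _ => hA i (by omega)⟩
    obtain ⟨l, hl, hlS⟩ := hC.2.2.2 ⟨m, hmk⟩ (Nat.zero_lt_of_lt hm)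
    have hint : ∀ (i : Fin k) (x : V), (i : ℕ) < m → x ∈ C i → x ∈ C ⟨m, hmk⟩ → x ∈ C l :=
      fun i x hi hx hxm => hlS (mem_sep.2 ⟨hxm, i, hi, hx⟩)
    have hcases : ∀ i : Fin k, (i : ℕ) < m + 1 → (i : ℕ) < m ∨ i = ⟨m, hmk⟩ :=
      fun i hi => (Nat.lt_succ_iff_lt_or_eq.mp hi).imp_right Fin.ext
    obtain hlA | hlA := hA l hl
    · have hstep : ∀ i : Fin k, (i : ℕ) < m → C i ∩ A ⊆ sep C j →
          C i ∩ (A ∪ C ⟨m, hmk⟩) ⊆ sep C j := by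
        rintro i hi h x ⟨hxi, hx | hx⟩
        · exact h ⟨hxi, hx⟩
        · by_contra hxS
          exact hxS (h ⟨hxi, hlA ⟨hint i x hi hxi hx, hxS⟩⟩)
      refine ⟨A ∪ C ⟨m, hmk⟩, fun i hi => (hlt i hi).trans Set.subset_union_left,
        hstep j hm hj, ?_, fun i hi => ?_⟩
      · rintro x (hx | hx)
        · exact (hsub x hx).imp fun i h => ⟨h.1.trans m.lt_succ_self, h.2⟩
        · exact ⟨⟨m, hmk⟩, m.lt_succ_self, hx⟩
      · obtain hi | rfl := hcases i hi
        · exact (hA i hi).imp (fun h => h.trans Set.subset_union_left) (hstep i hi)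
        · exact .inl (Set.sdiff_subset.trans Set.subset_union_right)
    · refine ⟨A, hlt, hj, fun x hx => (hsub x hx).imp fun i h => ⟨h.1.trans m.lt_succ_self, h.2⟩,
        fun i hi => ?_⟩
      obtain hi | rfl := hcases i hi
      · exact hA i hi
      · refine .inr fun x ⟨hxm, hxA⟩ => ?_
        obtain ⟨i, hi, hxi⟩ := hsub x hxA
        exact hlA ⟨hint i x hi hxi hxm, hxA⟩

theorem IsPerfectSeq.isSeparator_sep {V : Type*} [Finite V] {G : SimpleGraph V} {k : ℕ}
    {C : Fin k → Set V} (hC : IsPerfectSeq G C) {i j : Fin k} (hij : i < j) {a b : V}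
    (ha : a ∈ C i) (haS : a ∉ sep C j) (hb : b ∈ C j) (hbS : b ∉ sep C j) :
    IsSeparator G a b (sep C j) := by
  obtain ⟨A, hlt, hj, -, hA⟩ := hC.exists_side j k j.isLt
  refine isSeparator_of_closed haS hbS (hlt i hij ⟨ha, haS⟩) (fun h => hbS (hj ⟨hb, h⟩)) ?_
  intro u v huv hu hv huA
  obtain ⟨t, hst, ht⟩ := (SimpleGraph.isClique_pair.2 fun _ => huv).exists_isMaxClique
  obtain ⟨n, rfl⟩ := hC.2.2.1 t ht
  obtain h | h := hA n n.isLt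
  · exact h ⟨hst (by simp), hv⟩
  · exact absurd (h ⟨hst (by simp), huA⟩) hu

theorem IsPerfectSeq.isMinimalSeparator_sep {V : Type*} [Finite V] {G : SimpleGraph V} {k : ℕ}
    {C : Fin k → Set V} (hC : IsPerfectSeq G C) {j : Fin k} (hj : 0 < (j : ℕ)) :
    IsMinimalSeparator G (sep C j) := by
  obtain ⟨l, hl, hlS⟩ := hC.2.2.2 j hj
  obtain ⟨a, ha, haj⟩ :=
    (hC.2.1 l).exists_mem_notMem (hC.2.1 j) fun h => hl.ne (hC.1 h)
  obtain ⟨b, hb, hbl⟩ :=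
    (hC.2.1 j).exists_mem_notMem (hC.2.1 l) fun h => hl.ne' (hC.1 h)
  have hsep : IsSeparator G a b (sep C j) :=
    hC.isSeparator_sep hl ha (fun h => haj h.1) hb (fun h => hbl (hlS h))
  refine ⟨a, b, hsep.ne, hsep.not_adj, hsep, fun T hT h => ?_⟩
  obtain ⟨s, hs, hsT⟩ := Set.exists_of_ssubset hT
  have h' := h.of_isClique (hC.2.1 l).1 ha (hlS hs) hsT
  exact h'.not_adj ((hC.2.1 j).1 hs.1 hb h'.ne)

/-- Any set separating two vertices contains some `sep C j` separating the same vertices. -/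
theorem IsPerfectSeq.exists_sep_subset {V : Type*} [Finite V] {G : SimpleGraph V} {k : ℕ}
    {C : Fin k → Set V} (hC : IsPerfectSeq G C) {S : Set V} (m : ℕ) {a b : V}
    (ha : ∃ i : Fin k, (i : ℕ) < m ∧ a ∈ C i) (hb : ∃ i : Fin k, (i : ℕ) < m ∧ b ∈ C i)
    (h : IsSeparator G a b S) :
    ∃ j : Fin k, 0 < (j : ℕ) ∧ sep C j ⊆ S ∧ IsSeparator G a b (sep C j) := by
  induction m generalizing a b with
  | zero => obtain ⟨i, hi, -⟩ := ha; omega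
  | succ m ih =>
    have key : ∀ {a b : V} {i j : Fin k}, i < j → (j : ℕ) = m → a ∈ C j → b ∈ C i →
        IsSeparator G a b S →
        ∃ j : Fin k, 0 < (j : ℕ) ∧ sep C j ⊆ S ∧ IsSeparator G a b (sep C j) := by
      rintro a b i j hij rfl ha hb h
      by_cases hS : sep C j ⊆ S
      · exact ⟨j, Nat.zero_lt_of_lt hij, hS, (hC.isSeparator_sep hij hb (fun hx => h.2.1 (hS hx)) ha
          (fun hx => h.1 (hS hx))).symm⟩
      · obtain ⟨s, hs, hsS⟩ := Set.not_subset.1 hS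
        obtain ⟨hsj, n, hn, hsn⟩ := mem_sep.1 hs
        obtain ⟨q, hq, hqS, hsep⟩ :=
          ih ⟨n, hn, hsn⟩ ⟨i, hij, hb⟩ (h.of_isClique (hC.2.1 j).1 ha hsj hsS)
        exact ⟨q, hq, hqS, hsep.of_isClique (hC.2.1 j).1 hsj ha fun hx => h.1 (hqS hx)⟩
    obtain ⟨i, hi, hai⟩ := ha
    obtain ⟨n, hn, hbn⟩ := hb
    obtain him | him := Nat.lt_succ_iff_lt_or_eq.mp hi <;>
      obtain hnm | hnm := Nat.lt_succ_iff_lt_or_eq.mp hn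
    · exact ih ⟨i, him, hai⟩ ⟨n, hnm, hbn⟩ h
    · obtain ⟨q, hq, hqS, hsep⟩ := key (show i < n by omega) hnm hbn hai h.symm
      exact ⟨q, hq, hqS, hsep.symm⟩
    · exact key (show n < i by omega) him hai hbn h
    · obtain rfl : i = n := Fin.ext (him.trans hnm.symm)
      exact absurd ((hC.2.1 i).1 hai hbn h.ne) h.not_adj

/-- For a connected finite chordal simple graph with at least two maximal cliques and a
perfect sequence `C`, each separator `sep C j` (`0 < j`) is a minimal vertex separator,
and conversely every minimal vertex separator arises this way. -/
theorem stmt6 {V : Type*} [Fintype V] (G : SimpleGraph V)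
    (hconn : G.Connected) (hG : IsChordal G)
    {k : ℕ} (hk : 2 ≤ k) (C : Fin k → Set V) (hC : IsPerfectSeq G C) :
    (∀ j : Fin k, 0 < (j : ℕ) → IsMinimalSeparator G (sep C j)) ∧
    (∀ S : Set V, IsMinimalSeparator G S → ∃ j : Fin k, 0 < (j : ℕ) ∧ S = sep C j) := by
  have hmem : ∀ x : V, ∃ i : Fin k, (i : ℕ) < k ∧ x ∈ C i := fun x => by
    obtain ⟨t, hxt, ht⟩ := (G.isClique_singleton x).exists_isMaxClique
    obtain ⟨i, rfl⟩ := hC.2.2.1 t ht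
    exact ⟨i, i.isLt, hxt rfl⟩
  refine ⟨fun j hj => hC.isMinimalSeparator_sep hj, fun S ⟨a, b, _, _, hsep, hmin⟩ => ?_⟩
  obtain ⟨j, hj, hjS, hjsep⟩ := hC.exists_sep_subset k (hmem a) (hmem b) hsep
  refine ⟨j, hj, ?_⟩
  by_contra hne
  exact hmin _ (hjS.ssubset_of_ne (Ne.symm hne)) hjsep
end

section
/- Let Δ = C₁ ∪ C₂ be a finite set of variables with S = C₁ ∩ C₂, let n : I → ℕ be a cell frequency function with total count N = ∑_{i∈I} n(i) > 0, and for a ⊆ Δ and t ∈ I_a let r(t) = (∑_{j : j_a = t} n(j))/N be the marginal relative frequency. Define q : I → ℝ by q(i) = r(i_{C₁}) r(i_{C₂}) / r(i_S) if r(i_S) > 0 and q(i) = 0 otherwise. Then q is a probability distribution on I, i.e., q(i) ≥ 0 for all i and ∑_{i∈I} q(i) = 1, and its marginals agree with the empirical marginals: for every t ∈ I_{C₁}, ∑_{i : i_{C₁} = t} q(i) = r(t), and for every u ∈ I_{C₂}, ∑_{i : i_{C₂} = u} q(i) = r(u). -/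
open Finset

/-- The `a`-marginal of a cell `i`: the restriction of `i` to the coordinates in `a`. -/
def marg {Δ : Type*} {I : Δ → Type*} (i : ∀ δ, I δ) (a : Finset Δ) : ∀ δ : a, I δ.1 :=
  fun δ => i δ.1

theorem marg_eq_marg_iff {Δ : Type*} {I : Δ → Type*} {i j : ∀ δ, I δ} {a : Finset Δ} :
    marg i a = marg j a ↔ ∀ δ ∈ a, i δ = j δ :=
  ⟨fun h δ hδ => congrFun h ⟨δ, hδ⟩, fun h => funext fun δ => h δ.1 δ.2⟩

section Decomposition

variable {Δ : Type*} [Fintype Δ] [DecidableEq Δ] {I : Δ → Type*}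
  [∀ δ, Fintype (I δ)] [∀ δ, DecidableEq (I δ)]

/-- The total weight of the cells whose `a`-marginal is `t`. -/
def margSum (w : (∀ δ, I δ) → ℝ) (a : Finset Δ) (t : ∀ δ : a, I δ.1) : ℝ :=
  ∑ j ∈ univ.filter (fun j => marg j a = t), w j

/-- The decomposable weight built from the `C₁`-, `C₂`- and `S`-marginals of `w`. -/
noncomputable def decompWeight (w : (∀ δ, I δ) → ℝ) (C₁ C₂ S : Finset Δ) (i : ∀ δ, I δ) : ℝ :=
  if 0 < margSum w S (marg i S) then
    margSum w C₁ (marg i C₁) * margSum w C₂ (marg i C₂) / margSum w S (marg i S)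
  else 0

theorem margSum_nonneg {w : (∀ δ, I δ) → ℝ} (hw : ∀ i, 0 ≤ w i) (a : Finset Δ)
    (t : ∀ δ : a, I δ.1) : 0 ≤ margSum w a t :=
  sum_nonneg fun i _ => hw i

theorem sum_margSum (w : (∀ δ, I δ) → ℝ) (a : Finset Δ) : ∑ t, margSum w a t = ∑ i, w i :=
  sum_fiberwise univ (fun i => marg i a) w

theorem margSum_marg_anti {w : (∀ δ, I δ) → ℝ} (hw : ∀ i, 0 ≤ w i) {a b : Finset Δ}
    (hab : a ⊆ b) (i : ∀ δ, I δ) : margSum w b (marg i b) ≤ margSum w a (marg i a) := by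
  refine sum_le_sum_of_subset_of_nonneg ?_ fun j _ _ => hw j
  intro j
  simp only [mem_filter, mem_univ, true_and, marg_eq_marg_iff]
  exact fun h δ hδ => h δ (hab hδ)

theorem decompWeight_nonneg {w : (∀ δ, I δ) → ℝ} (hw : ∀ i, 0 ≤ w i) (C₁ C₂ S : Finset Δ)
    (i : ∀ δ, I δ) : 0 ≤ decompWeight w C₁ C₂ S i := by
  unfold decompWeight
  split_ifs with h
  · exact div_nonneg (mul_nonneg (margSum_nonneg hw _ _) (margSum_nonneg hw _ _)) h.le
  · exact le_rfl

theorem decompWeight_swap (w : (∀ δ, I δ) → ℝ) (C₁ C₂ S : Finset Δ) :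
    decompWeight w C₁ C₂ S = decompWeight w C₂ C₁ S := by
  funext i
  simp only [decompWeight, mul_comm]

/-- Cells with prescribed marginals on two sets covering `Δ` are unique, and exist exactly when
the prescribed marginals are compatible on the intersection. -/
theorem card_filter_marg_eq {C₁ C₂ S : Finset Δ} (hU : C₁ ∪ C₂ = univ) (hS : S = C₁ ∩ C₂)
    (k j : ∀ δ, I δ) :
    #{i : ∀ δ, I δ | marg i C₁ = marg k C₁ ∧ marg j C₂ = marg i C₂} =
      if marg j S = marg k S then 1 else 0 := by
  subst hS
  simp only [marg_eq_marg_iff, mem_inter]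
  split_ifs with h
  · refine card_eq_one.2 ⟨fun δ => if δ ∈ C₁ then k δ else j δ, ?_⟩
    ext i
    simp only [mem_filter, mem_univ, true_and, mem_singleton]
    constructor
    · rintro ⟨h₁, h₂⟩
      funext δ
      have hδ : δ ∈ C₁ ∪ C₂ := hU ▸ mem_univ δ
      split_ifs with hδ₁
      · exact h₁ δ hδ₁
      · exact (h₂ δ ((mem_union.1 hδ).resolve_left hδ₁)).symm
    · rintro rfl
      refine ⟨fun δ hδ => if_pos hδ, fun δ hδ => ?_⟩
      dsimp only
      split_ifs with hδ₁
      · exact h δ ⟨hδ₁, hδ⟩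
      · rfl
  · refine card_eq_zero.2 (filter_eq_empty_iff.2 ?_)
    rintro i - ⟨h₁, h₂⟩
    exact h fun δ hδ => (h₂ δ hδ.2).trans (h₁ δ hδ.1)

theorem sum_margSum_marg {C₁ C₂ S : Finset Δ} (hU : C₁ ∪ C₂ = univ) (hS : S = C₁ ∩ C₂)
    (w : (∀ δ, I δ) → ℝ) (k : ∀ δ, I δ) :
    ∑ i ∈ univ.filter (fun i => marg i C₁ = marg k C₁), margSum w C₂ (marg i C₂) =
      margSum w S (marg k S) := by
  have h (j : ∀ δ, I δ) := card_filter_marg_eq hU hS k j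
  simp only [margSum, sum_filter (fun j => marg j _ = marg _ _) w]
  rw [sum_comm]
  refine sum_congr rfl fun j _ => ?_
  rw [← sum_filter, filter_filter, sum_const, h j]
  split_ifs <;> simp

theorem sum_decompWeight_filter {C₁ C₂ S : Finset Δ} (hU : C₁ ∪ C₂ = univ) (hS : S = C₁ ∩ C₂)
    {w : (∀ δ, I δ) → ℝ} (hw : ∀ i, 0 ≤ w i) (t : ∀ δ : C₁, I δ.1) :
    ∑ i ∈ univ.filter (fun i => marg i C₁ = t), decompWeight w C₁ C₂ S i = margSum w C₁ t := by
  rcases (margSum_nonneg hw C₁ t).eq_or_lt with h0 | hpos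
  · rw [← h0]
    refine sum_eq_zero fun i hi => ?_
    simp [decompWeight, (mem_filter.1 hi).2, ← h0]
  · obtain ⟨k, hk, -⟩ := exists_ne_zero_of_sum_ne_zero hpos.ne'
    obtain rfl : marg k C₁ = t := (mem_filter.1 hk).2
    have hS₁ : S ⊆ C₁ := hS ▸ inter_subset_left
    have hSpos : 0 < margSum w S (marg k S) := hpos.trans_le (margSum_marg_anti hw hS₁ k)
    have hq : ∀ i ∈ univ.filter (fun i => marg i C₁ = marg k C₁), decompWeight w C₁ C₂ S i =
        margSum w C₁ (marg k C₁) / margSum w S (marg k S) * margSum w C₂ (marg i C₂) := by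
      intro i hi
      have hi₁ := (mem_filter.1 hi).2
      have hiS : marg i S = marg k S :=
        marg_eq_marg_iff.2 fun δ hδ => marg_eq_marg_iff.1 hi₁ δ (hS₁ hδ)
      rw [decompWeight, hiS, hi₁, if_pos hSpos, div_mul_eq_mul_div]
    rw [sum_congr rfl hq, ← mul_sum, sum_margSum_marg hU hS, div_mul_cancel₀ _ hSpos.ne']

theorem sum_decompWeight {C₁ C₂ S : Finset Δ} (hU : C₁ ∪ C₂ = univ) (hS : S = C₁ ∩ C₂)
    {w : (∀ δ, I δ) → ℝ} (hw : ∀ i, 0 ≤ w i) :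
    ∑ i, decompWeight w C₁ C₂ S i = ∑ i, w i := by
  rw [← sum_margSum _ C₁, ← sum_margSum w C₁]
  exact sum_congr rfl fun t _ => sum_decompWeight_filter hU hS hw t

end Decomposition

/-- Let `Δ = C₁ ∪ C₂`, `S = C₁ ∩ C₂`, let `n` be a cell frequency function with positive
total count `N`, and let `r a t` be the relative frequency of the `a`-marginal cell `t`.
Define `q i = r C₁ (i_{C₁}) * r C₂ (i_{C₂}) / r S (i_S)` when `r S (i_S) > 0` and
`q i = 0` otherwise.  Then `q` is a probability distribution on the set of cells and its
`C₁`- and `C₂`-marginals agree with the empirical marginals. -/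
theorem stmt10 {Δ : Type*} [Fintype Δ] [DecidableEq Δ] {I : Δ → Type*}
    [∀ δ, Fintype (I δ)] [∀ δ, DecidableEq (I δ)]
    (C₁ C₂ : Finset Δ) (hU : C₁ ∪ C₂ = Finset.univ)
    (n : (∀ δ, I δ) → ℕ) (hN : 0 < ∑ i, n i) :
    let S : Finset Δ := C₁ ∩ C₂
    let N : ℝ := ∑ i, (n i : ℝ)
    let r : (a : Finset Δ) → (∀ δ : a, I δ.1) → ℝ := fun a t =>
      (∑ j ∈ univ.filter (fun j => marg j a = t), (n j : ℝ)) / N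
    let q : (∀ δ, I δ) → ℝ := fun i =>
      if 0 < r S (marg i S) then r C₁ (marg i C₁) * r C₂ (marg i C₂) / r S (marg i S)
      else 0
    (∀ i, 0 ≤ q i) ∧ (∑ i, q i = 1) ∧
    (∀ t : ∀ δ : C₁, I δ.1, ∑ i ∈ univ.filter (fun i => marg i C₁ = t), q i = r C₁ t) ∧
    (∀ u : ∀ δ : C₂, I δ.1, ∑ i ∈ univ.filter (fun i => marg i C₂ = u), q i = r C₂ u) := by
  intro S N r q
  have hNpos : 0 < N := by
    have : (0 : ℝ) < ((∑ i, n i : ℕ) : ℝ) := Nat.cast_pos.2 hN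
    rwa [Nat.cast_sum] at this
  set w : (∀ δ, I δ) → ℝ := fun i => n i / N with hw_def
  have hw : ∀ i, 0 ≤ w i := fun i => div_nonneg (Nat.cast_nonneg _) hNpos.le
  have hr : r = margSum w := by
    funext a t
    exact sum_div _ _ _
  have hq : q = decompWeight w C₁ C₂ S := by
    funext i
    simp only [q, hr, decompWeight]
  have hU' : C₂ ∪ C₁ = univ := by rw [union_comm, hU]
  rw [hq, hr]
  refine ⟨decompWeight_nonneg hw C₁ C₂ S, ?_, sum_decompWeight_filter hU rfl hw, ?_⟩
  · rw [sum_decompWeight hU rfl hw, hw_def, ← sum_div]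
    exact div_self hNpos.ne'
  · rw [decompWeight_swap]
    exact sum_decompWeight_filter hU' (inter_comm C₁ C₂) hw
end
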